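/- Let h ∈ ((√5 − 1)/2, 1] and define w̄(γ) = (1 + γ·(2h−1))/2. Then γ̂ = (√5 − 2)/(2h−1) lies in (0,1), one has 1 − w̄(γ) > w̄(γ)² for γ ∈ (0, γ̂) and 1 − w̄(γ) < w̄(γ)² for γ ∈ (γ̂, 1), and the high-quality firm's equilibrium profit max(1 − w̄(γ), w̄(γ)²) is strictly decreasing in γ on (0, γ̂) and strictly increasing in γ on (γ̂, 1). -/

import Mathlib

open Set

noncomputable def wbar (h γ : ℝ) : ℝ := (1 + γ * (2*h - 1))/2

theorem wbar_strictMono {h : ℝ} (hh : 0 < 2*h - 1) : StrictMono (wbar h) := by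
  intro a b hab
  have := mul_lt_mul_of_pos_right hab hh
  unfold wbar
  linarith

theorem wbar_cutoff {h : ℝ} (hh : 0 < 2*h - 1) :
    wbar h ((Real.sqrt 5 - 2)/(2*h - 1)) = (Real.sqrt 5 - 1)/2 := by
  unfold wbar
  rw [div_mul_cancel₀ _ hh.ne']
  ring

theorem wbar_pos {h γ : ℝ} (hh : 0 < 2*h - 1) (hγ : 0 < γ) : 0 < wbar h γ := by
  unfold wbar
  positivity

/-- The positive root of `w ^ 2 = 1 - w` is `(√5 - 1) / 2`. -/
theorem sq_lt_one_sub {w : ℝ} (hw : 0 < w) (hlt : w < (Real.sqrt 5 - 1)/2) :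
    w^2 < 1 - w := by
  nlinarith [Real.sq_sqrt (show (0:ℝ) ≤ 5 by norm_num)]

theorem one_sub_lt_sq {w : ℝ} (hw : 0 < w) (hlt : (Real.sqrt 5 - 1)/2 < w) :
    1 - w < w^2 := by
  nlinarith [Real.sq_sqrt (show (0:ℝ) ≤ 5 by norm_num), Real.sqrt_nonneg 5]

/-- For `h ∈ ((√5−1)/2, 1]`, the cutoff `γ̂ = (√5−2)/(2h−1)` lies in `(0,1)`;
`1 − w̄(γ) > w̄(γ)²` below `γ̂` and `1 − w̄(γ) < w̄(γ)²` above it, and the high-quality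
equilibrium profit `max(1 − w̄(γ), w̄(γ)²)` is strictly decreasing on `(0, γ̂)` and
strictly increasing on `(γ̂, 1)`. -/
theorem stmt17 (h : ℝ) (hh : h ∈ Ioc ((Real.sqrt 5 - 1)/2) 1) :
    (Real.sqrt 5 - 2)/(2*h - 1) ∈ Ioo (0:ℝ) 1 ∧
    (∀ γ ∈ Ioo (0:ℝ) ((Real.sqrt 5 - 2)/(2*h - 1)), (wbar h γ)^2 < 1 - wbar h γ) ∧
    (∀ γ ∈ Ioo ((Real.sqrt 5 - 2)/(2*h - 1)) 1, 1 - wbar h γ < (wbar h γ)^2) ∧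
    StrictAntiOn (fun γ => max (1 - wbar h γ) ((wbar h γ)^2))
      (Ioo (0:ℝ) ((Real.sqrt 5 - 2)/(2*h - 1))) ∧
    StrictMonoOn (fun γ => max (1 - wbar h γ) ((wbar h γ)^2))
      (Ioo ((Real.sqrt 5 - 2)/(2*h - 1)) 1) := by
  have h2 : 2 < Real.sqrt 5 := Real.lt_sqrt_of_sq_lt (by norm_num)
  have hpos : 0 < 2*h - 1 := by linarith [hh.1]
  have hmono := wbar_strictMono hpos
  have hcut := wbar_cutoff hpos
  have hcut_pos : 0 < (Real.sqrt 5 - 2)/(2*h - 1) := div_pos (by linarith) hpos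
  have below : ∀ γ ∈ Ioo (0:ℝ) ((Real.sqrt 5 - 2)/(2*h - 1)),
      (wbar h γ)^2 < 1 - wbar h γ := fun γ hγ =>
    sq_lt_one_sub (wbar_pos hpos hγ.1) (hcut ▸ hmono hγ.2)
  have above : ∀ γ ∈ Ioo ((Real.sqrt 5 - 2)/(2*h - 1)) 1,
      1 - wbar h γ < (wbar h γ)^2 := fun γ hγ =>
    one_sub_lt_sq (wbar_pos hpos (hcut_pos.trans hγ.1)) (hcut ▸ hmono hγ.1)
  refine ⟨⟨hcut_pos, ?_⟩, below, above, ?_, ?_⟩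
  · rw [div_lt_one hpos]
    linarith [hh.1]
  · intro a ha b hb hab
    simp only [max_eq_left (below a ha).le, max_eq_left (below b hb).le]
    linarith [hmono hab]
  · intro a ha b hb hab
    simp only [max_eq_right (above a ha).le, max_eq_right (above b hb).le]
    exact pow_lt_pow_left₀ (hmono hab) (wbar_pos hpos (hcut_pos.trans ha.1)).le two_ne_zero
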